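/- arXiv:1111.6633 — 2 statements merged into one kernel-verified Lean document; each statement's English description precedes it below -/
import Mathlib

section
/- In the counterexample market with parameter n ≥ 1, the transaction-cost value is finite: J = sup E[log φ⁰_2] < ∞, where the supremum runs over all liquidating self-financing strategies with pre-trade initial position (4, −1) and φ⁰_2 > 0 a.s. -/
open MeasureTheory ENNReal Filter

noncomputable section

/-- Sample space of the counterexample market: first coordinate `k ∈ ℕ`,
second coordinate the Bernoulli outcome at time 2 (`true` = ask price jumps up). -/
abbrev Omega : Type := ℕ × Bool

/-- `q n k = 2^{-(n+k)}` as an extended nonnegative real. -/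
def q (n k : ℕ) : ℝ≥0∞ := (2 : ℝ≥0∞)⁻¹ ^ (n + k)

/-- The first-coordinate probabilities: `p 0 = 1 - 2^{-n}`, `p k = 2^{-(n+k)}` for `k ≥ 1`. -/
def pk (n : ℕ) (k : ℕ) : ℝ≥0∞ := if k = 0 then 1 - (2 : ℝ≥0∞)⁻¹ ^ n else (2 : ℝ≥0∞)⁻¹ ^ (n + k)

/-- The weight of each atom `(k, j)` of the counterexample market. -/
def w (n : ℕ) : Omega → ℝ≥0∞
  | (k, true) => pk n k * q n k
  | (k, false) => pk n k * (1 - q n k)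

/-- The probability measure of the counterexample market with parameter `n`. -/
def P (n : ℕ) : Measure Omega := Measure.sum (fun ω => w n ω • Measure.dirac ω)

/-- Ask price of the risky asset at time 1 in the state with first coordinate `k`. -/
def ask1 (k : ℕ) : ℝ := 2 + k

/-- Ask price of the risky asset at time 2. -/
def ask2 : Omega → ℝ
  | (k, true) => 3 + k
  | (_, false) => 1

/-- A (trading) strategy, given by holdings in the safe asset (`a`) and the risky asset (`b`)
at times `0,1,2`; adaptedness to the filtration (trivial at time 0, generated by the first
coordinate at time 1, everything at time 2) is encoded by the arguments of the functions. -/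
structure Strat where
  a0 : ℝ
  b0 : ℝ
  a1 : ℕ → ℝ
  b1 : ℕ → ℝ
  a2 : Omega → ℝ
  b2 : Omega → ℝ

/-- Self-financing condition with transaction costs, from pre-trade initial position
`(x0, y0)`: purchases are made at the ask price, sales at the bid price. -/
def SelfFinancingTC (x0 y0 : ℝ) (φ : Strat) : Prop :=
  (φ.a0 - x0 ≤ -(max (φ.b0 - y0) 0) * 3 + max (y0 - φ.b0) 0 * 3) ∧
  (∀ k : ℕ, φ.a1 k - φ.a0 ≤ -(max (φ.b1 k - φ.b0) 0) * ask1 k + max (φ.b0 - φ.b1 k) 0 * 2) ∧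
  (∀ ω : Omega,
    φ.a2 ω - φ.a1 ω.1 ≤ -(max (φ.b2 ω - φ.b1 ω.1) 0) * ask2 ω + max (φ.b1 ω.1 - φ.b2 ω) 0 * 1)

/-- An adapted (to the filtration of the counterexample market) real-valued price process. -/
structure PriceProc where
  s0 : ℝ
  s1 : ℕ → ℝ
  s2 : Omega → ℝ

/-- A price process valued in the bid-ask spread `[S̲, S̄]`. -/
def SpreadValued (S : PriceProc) : Prop :=
  S.s0 = 3 ∧ (∀ k : ℕ, 2 ≤ S.s1 k ∧ S.s1 k ≤ ask1 k) ∧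
    (∀ ω : Omega, 1 ≤ S.s2 ω ∧ S.s2 ω ≤ ask2 ω)

/-- Frictionless self-financing condition for the price process `S`, from pre-trade
initial position `(x0, y0)`. -/
def SelfFinancingFL (x0 y0 : ℝ) (S : PriceProc) (φ : Strat) : Prop :=
  (φ.a0 - x0 = -(φ.b0 - y0) * S.s0) ∧
  (∀ k : ℕ, φ.a1 k - φ.a0 = -(φ.b1 k - φ.b0) * S.s1 k) ∧
  (∀ ω : Omega, φ.a2 ω - φ.a1 ω.1 = -(φ.b2 ω - φ.b1 ω.1) * S.s2 ω)

/-- Expected logarithmic utility `E[log f]`, with values in the extended reals. -/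
def elog (μ : Measure Omega) (f : Omega → ℝ) : EReal :=
  ((∫⁻ ω, ENNReal.ofReal (Real.log (f ω)) ∂μ : ℝ≥0∞) : EReal) -
    ((∫⁻ ω, ENNReal.ofReal (-Real.log (f ω)) ∂μ : ℝ≥0∞) : EReal)

/-- Admissibility for the transaction-cost problem with pre-trade initial position `(4, -1)`:
self-financing, liquidating, with strictly positive terminal wealth a.s. -/
def AdmissibleTC (n : ℕ) (φ : Strat) : Prop :=
  SelfFinancingTC 4 (-1) φ ∧ (∀ ω : Omega, φ.b2 ω = 0) ∧ (∀ᵐ ω ∂(P n), 0 < φ.a2 ω)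

/-- The value `J` of the transaction-cost utility maximization problem. -/
def JTC (n : ℕ) : EReal :=
  sSup {x : EReal | ∃ φ : Strat, AdmissibleTC n φ ∧ x = elog (P n) φ.a2}

/-- Admissibility for the frictionless problem for `S` with pre-trade initial position `(4, -1)`. -/
def AdmissibleFL (n : ℕ) (S : PriceProc) (φ : Strat) : Prop :=
  SelfFinancingFL 4 (-1) S φ ∧ (∀ ω : Omega, φ.b2 ω = 0) ∧ (∀ᵐ ω ∂(P n), 0 < φ.a2 ω)

/-- The value `J(S̃)` of the frictionless utility maximization problem for the price process `S̃`. -/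
def JFL (n : ℕ) (S : PriceProc) : EReal :=
  sSup {x : EReal | ∃ φ : Strat, AdmissibleFL n S φ ∧ x = elog (P n) φ.a2}

end

theorem pk_ne_zero {n : ℕ} (hn : 1 ≤ n) (k : ℕ) : pk n k ≠ 0 := by
  unfold pk
  split_ifs
  · refine (tsub_pos_of_lt (pow_lt_one₀ zero_le ?_ (by omega))).ne'
    exact ENNReal.inv_lt_one.2 ENNReal.one_lt_two
  · simp

theorem q_ne_zero (n k : ℕ) : q n k ≠ 0 := by
  simp [q]

theorem pk_le (n k : ℕ) : pk n k ≤ (2 : ℝ≥0∞)⁻¹ ^ k := by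
  unfold pk
  split_ifs with h
  · simp [h]
  · exact pow_le_pow_of_le_one zero_le (ENNReal.inv_le_one.2 one_le_two) (by omega)

theorem w_le (n : ℕ) (ω : Omega) : w n ω ≤ (2 : ℝ≥0∞)⁻¹ ^ ω.1 := by
  rcases ω with ⟨k, _ | _⟩
  · exact (mul_le_of_le_one_right' tsub_le_self).trans (pk_le n k)
  · refine (mul_le_of_le_one_right' ?_).trans (pk_le n k)
    exact pow_le_one₀ zero_le (ENNReal.inv_le_one.2 one_le_two)

theorem P_univ_lt_top (n : ℕ) : P n Set.univ < ⊤ := by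
  have h : P n Set.univ = ∑' ω, w n ω := by
    simp [P, Measure.sum_apply]
  rw [h]
  refine (ENNReal.tsum_le_tsum (w_le n)).trans_lt ?_
  rw [ENNReal.tsum_prod (f := fun k (_ : Bool) => (2 : ℝ≥0∞)⁻¹ ^ k)]
  simp only [tsum_bool, ENNReal.tsum_add, ENNReal.tsum_geometric, ENNReal.one_sub_inv_two, inv_inv]
  exact ENNReal.add_lt_top.2 ⟨ENNReal.ofNat_lt_top, ENNReal.ofNat_lt_top⟩

/-- Every jump-up state has positive probability, so almost sure properties hold there. -/
theorem of_ae_P {n : ℕ} (hn : 1 ≤ n) {p : Omega → Prop} (h : ∀ᵐ ω ∂(P n), p ω) (k : ℕ) :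
    p (k, true) := by
  have hw : w n (k, true) ≠ 0 := mul_ne_zero (pk_ne_zero hn k) (q_ne_zero n k)
  have hk := Measure.ae_sum_iff.1 h (k, true)
  rwa [Measure.ae_ennreal_smul_measure_eq hw, ae_dirac_eq, eventually_pure] at hk

/-- A purchase or sale with bid price at most `s` and ask price at least `s` is no better
than frictionless trading at the price `s`. -/
theorem trade_le {x bid ask s : ℝ} (hbid : bid ≤ s) (hask : s ≤ ask) :
    -(max x 0) * ask + max (-x) 0 * bid ≤ -x * s := by
  rcases le_total 0 x with hx | hx
  · rw [max_eq_left hx, max_eq_right (by linarith)]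
    nlinarith
  · rw [max_eq_right hx, max_eq_left (by linarith)]
    nlinarith

/-- Wealth along a transaction-cost strategy is bounded by the wealth from trading the same
risky holdings frictionlessly at any price within the spread. -/
theorem terminal_wealth_le_of_spread {φ : Strat} (h : SelfFinancingTC 4 (-1) φ)
    (hb : ∀ ω, φ.b2 ω = 0) (ω : Omega) {s t : ℝ} (hs : 2 ≤ s) (hs' : s ≤ 2 + ω.1)
    (ht : 1 ≤ t) (ht' : t ≤ ask2 ω) :
    φ.a2 ω ≤ 1 + φ.b0 * (s - 3) + φ.b1 ω.1 * (t - s) := by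
  obtain ⟨h0, h1, h2⟩ := h
  have h1 := h1 ω.1
  have h2 := h2 ω
  have e0 := trade_le (x := φ.b0 - -1) (le_refl (3 : ℝ)) le_rfl
  have e1 := trade_le (x := φ.b1 ω.1 - φ.b0) hs hs'
  have e2 := trade_le (x := φ.b2 ω - φ.b1 ω.1) ht ht'
  simp only [neg_sub, ask1, hb] at h1 h2 e0 e1 e2
  linarith

theorem terminal_wealth_le {φ : Strat} (h : SelfFinancingTC 4 (-1) φ) (hb : ∀ ω, φ.b2 ω = 0)
    (hpos : ∀ k, 0 < φ.a2 (k, true)) (ω : Omega) : φ.a2 ω ≤ 4 := by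
  have hb0 : -1 < φ.b0 := by
    have := terminal_wealth_le_of_spread h hb (2, true) (s := 4) (t := 4) (by norm_num)
      (by norm_num) (by norm_num) (by norm_num [ask2])
    linarith [hpos 2]
  obtain ⟨k, j⟩ := ω
  have hk : (0 : ℝ) ≤ k := k.cast_nonneg
  have hask : 1 ≤ ask2 (k, j) := by cases j <;> simp only [ask2] <;> linarith
  have hup := terminal_wealth_le_of_spread h hb (k, true) (s := 2) (t := 3) le_rfl
    (by simp) (by norm_num) (by simp [ask2])
  have hlow := terminal_wealth_le_of_spread h hb (k, j) (s := 2) (t := 1) le_rfl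
    (by simp) le_rfl hask
  simp only at hup hlow
  linarith [hpos k]

theorem elog_le {μ : Measure Omega} {f : Omega → ℝ} {c : ℝ} (hf : ∀ ω, f ω ≤ c)
    (hpos : ∀ᵐ ω ∂μ, 0 < f ω) :
    elog μ f ≤ ((ENNReal.ofReal (Real.log c) * μ Set.univ : ℝ≥0∞) : EReal) := by
  refine (EReal.sub_le_sub le_rfl (EReal.coe_ennreal_nonneg _)).trans ?_
  rw [sub_zero, EReal.coe_ennreal_le_coe_ennreal_iff, ← lintegral_const]
  refine lintegral_mono_ae ?_
  filter_upwards [hpos] with ω hω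
  exact ENNReal.ofReal_le_ofReal (Real.log_le_log hω (hf ω))

/-- the transaction-cost value `J` of the counterexample market is finite. -/
theorem stmt_4 (n : ℕ) (hn : 1 ≤ n) : JTC n < ⊤ := by
  have hle : JTC n ≤ ((ENNReal.ofReal (Real.log 4) * P n Set.univ : ℝ≥0∞) : EReal) := by
    refine sSup_le ?_
    rintro x ⟨φ, ⟨hsf, hb, hpos⟩, rfl⟩
    exact elog_le (terminal_wealth_le hsf hb (of_ae_P hn hpos)) hpos
  refine hle.trans_lt ?_
  rw [lt_top_iff_ne_top, Ne, EReal.coe_ennreal_eq_top_iff]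
  exact (ENNReal.mul_lt_top ENNReal.ofReal_lt_top (P_univ_lt_top n)).ne
end

section
/- In the counterexample market with parameter n ≥ 1, under short selling constraints and with initial position (x, 0) for x > 0: the constrained transaction-cost value equals log x (no trade is optimal), and for every spread-valued adapted process S̃ that is a supermartingale with respect to the filtration, the constrained frictionless value for S̃ also equals log x. Consequently every spread-valued adapted supermartingale S̃ is a shadow price for the constrained problem; in particular shadow prices need not be unique. -/
open MeasureTheory ENNReal Filter

/-- The short selling constraint: all holdings are nonnegative at all times. -/
def NoShort (φ : Strat) : Prop :=
  0 ≤ φ.a0 ∧ 0 ≤ φ.b0 ∧ (∀ k : ℕ, 0 ≤ φ.a1 k ∧ 0 ≤ φ.b1 k) ∧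
    (∀ ω : Omega, 0 ≤ φ.a2 ω ∧ 0 ≤ φ.b2 ω)

/-- The constrained transaction-cost value with initial position `(x, 0)`. -/
noncomputable def JTCc (n : ℕ) (x : ℝ) : EReal :=
  sSup {v : EReal | ∃ φ : Strat, SelfFinancingTC x 0 φ ∧ NoShort φ ∧
    (∀ ω : Omega, φ.b2 ω = 0) ∧ (∀ᵐ ω ∂(P n), 0 < φ.a2 ω) ∧ v = elog (P n) φ.a2}

/-- The constrained frictionless value for the price process `S` with initial position `(x, 0)`. -/
noncomputable def JFLc (n : ℕ) (x : ℝ) (S : PriceProc) : EReal :=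
  sSup {v : EReal | ∃ φ : Strat, SelfFinancingFL x 0 S φ ∧ NoShort φ ∧
    (∀ ω : Omega, φ.b2 ω = 0) ∧ (∀ᵐ ω ∂(P n), 0 < φ.a2 ω) ∧ v = elog (P n) φ.a2}

/-- An adapted price process which is a supermartingale with respect to the filtration of
the counterexample market (trivial at time 0, generated by the first coordinate at time 1). -/
def IsSupermartingaleProc (n : ℕ) (S : PriceProc) : Prop :=
  (∫ ω : Omega, S.s1 ω.1 ∂(P n)) ≤ S.s0 ∧
  ∀ k : ℕ, (∫ ω in {ω : Omega | ω.1 = k}, S.s2 ω ∂(P n))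
      ≤ S.s1 k * (P n {ω : Omega | ω.1 = k}).toReal

theorem w_true_add_w_false (n k : ℕ) : w n (k, true) + w n (k, false) = pk n k := by
  have hq : q n k ≤ 1 := pow_le_one₀ zero_le (by norm_num)
  simp only [w]
  rw [← mul_add, add_tsub_cancel_of_le hq, mul_one]

theorem lintegral_P (n : ℕ) (f : Omega → ℝ≥0∞) :
    ∫⁻ ω, f ω ∂(P n) = ∑' k, (w n (k, true) * f (k, true) + w n (k, false) * f (k, false)) := by
  rw [P, lintegral_sum_measure]
  simp only [lintegral_smul_measure, lintegral_dirac, smul_eq_mul]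
  rw [ENNReal.tsum_prod']
  refine tsum_congr fun k => ?_
  rw [tsum_bool, add_comm]

theorem lintegral_P_fst (n : ℕ) (g : ℕ → ℝ≥0∞) :
    ∫⁻ ω, g ω.1 ∂(P n) = ∑' k, pk n k * g k := by
  rw [lintegral_P]
  exact tsum_congr fun k => by rw [← add_mul, w_true_add_w_false]

theorem tsum_pk (n : ℕ) : ∑' k, pk n k = 1 := by
  rw [tsum_eq_zero_add' ENNReal.summable]
  have h1 : ∀ k, pk n (k + 1) = (2 : ℝ≥0∞)⁻¹ ^ n * (2 : ℝ≥0∞)⁻¹ ^ (k + 1) := fun k => by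
    simp [pk, pow_add]
  simp only [h1]
  rw [ENNReal.tsum_mul_left, ENNReal.tsum_geometric_add_one, ENNReal.one_sub_inv_two, inv_inv,
    ENNReal.inv_mul_cancel (by norm_num) (by norm_num), mul_one]
  simp only [pk, if_true]
  exact tsub_add_cancel_of_le (pow_le_one₀ zero_le (by norm_num))

instance isProbabilityMeasure_P (n : ℕ) : IsProbabilityMeasure (P n) := by
  constructor
  rw [← lintegral_one, lintegral_P_fst n (fun _ => 1)]
  simpa using tsum_pk n

theorem setLIntegral_P (n k : ℕ) (f : Omega → ℝ≥0∞) :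
    ∫⁻ ω in {ω : Omega | ω.1 = k}, f ω ∂(P n)
      = w n (k, true) * f (k, true) + w n (k, false) * f (k, false) := by
  rw [← lintegral_indicator (MeasurableSet.of_discrete), lintegral_P, tsum_eq_single k]
  · simp
  · intro b hb
    simp [Set.indicator, hb]

theorem P_fst_eq (n k : ℕ) : P n {ω : Omega | ω.1 = k} = pk n k := by
  rw [← setLIntegral_one, setLIntegral_P n k (fun _ => 1)]
  simpa using w_true_add_w_false n k

theorem tsum_pk_mul_ask1_ne_top (n : ℕ) : ∑' k, pk n k * ENNReal.ofReal (ask1 k) ≠ ∞ := by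
  have hs : Summable fun k : ℕ => (2 : ℝ)⁻¹ ^ k * ask1 k := by
    have h1 : Summable fun k : ℕ => (k : ℝ) ^ 1 * (2 : ℝ)⁻¹ ^ k :=
      summable_pow_mul_geometric_of_norm_lt_one 1 (by norm_num)
    have h2 : Summable fun k : ℕ => (2 : ℝ)⁻¹ ^ k :=
      summable_geometric_of_lt_one (by norm_num) (by norm_num)
    refine ((h2.mul_left 2).add h1).congr fun k => ?_
    simp only [ask1]
    ring
  refine ne_top_of_le_ne_top hs.tsum_ofReal_ne_top (ENNReal.tsum_le_tsum fun k => ?_)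
  rw [ENNReal.ofReal_mul (by positivity), ENNReal.ofReal_pow (by norm_num),
    ENNReal.ofReal_inv_of_pos (by norm_num), ENNReal.ofReal_ofNat]
  gcongr
  exact pk_le n k

theorem SpreadValued.integrable_s1 {S : PriceProc} (hS : SpreadValued S) (n : ℕ) :
    Integrable (fun ω : Omega => S.s1 ω.1) (P n) := by
  refine ⟨Measurable.of_discrete.aestronglyMeasurable, ?_⟩
  rw [hasFiniteIntegral_iff_ofReal (ae_of_all _ fun ω => by
      have := (hS.2.1 ω.1).1
      simp only [Pi.zero_apply]
      linarith),
    lintegral_P_fst n (fun k => ENNReal.ofReal (S.s1 k))]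
  refine lt_of_le_of_lt (ENNReal.tsum_le_tsum fun k => ?_) (tsum_pk_mul_ask1_ne_top n).lt_top
  gcongr
  exact (hS.2.1 k).2

theorem IsSupermartingaleProc.tsum_s1_le {n : ℕ} {S : PriceProc}
    (h : IsSupermartingaleProc n S) (hS : SpreadValued S) :
    ∑' k, pk n k * ENNReal.ofReal (S.s1 k) ≤ ENNReal.ofReal S.s0 := by
  rw [← lintegral_P_fst n (fun k => ENNReal.ofReal (S.s1 k)),
    ← ofReal_integral_eq_lintegral_ofReal (hS.integrable_s1 n)
      (ae_of_all _ fun ω => by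
        have := (hS.2.1 ω.1).1
        simp only [Pi.zero_apply]
        linarith)]
  exact ENNReal.ofReal_le_ofReal h.1

theorem IsSupermartingaleProc.sum_s2_le {n : ℕ} {S : PriceProc}
    (h : IsSupermartingaleProc n S) (hS : SpreadValued S) (k : ℕ) :
    w n (k, true) * ENNReal.ofReal (S.s2 (k, true))
        + w n (k, false) * ENNReal.ofReal (S.s2 (k, false))
      ≤ pk n k * ENNReal.ofReal (S.s1 k) := by
  have h_nonneg : ∀ ω, 0 ≤ S.s2 ω := fun ω => zero_le_one.trans (hS.2.2 ω).1
  have h_int : IntegrableOn S.s2 {ω : Omega | ω.1 = k} (P n) := by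
    refine Measure.integrableOn_of_bounded (M := 3 + k) (measure_ne_top _ _)
      Measurable.of_discrete.aestronglyMeasurable ?_
    refine (ae_restrict_iff' MeasurableSet.of_discrete).2 (ae_of_all _ ?_)
    rintro ⟨m, j⟩ rfl
    rw [Real.norm_of_nonneg (h_nonneg _)]
    refine (hS.2.2 _).2.trans ?_
    cases j
    · simp only [ask2]
      linarith [Nat.cast_nonneg (α := ℝ) m]
    · simp [ask2]
  rw [← setLIntegral_P n k (fun ω => ENNReal.ofReal (S.s2 ω)),
    ← ofReal_integral_eq_lintegral_ofReal h_int (ae_of_all _ h_nonneg)]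
  refine (ENNReal.ofReal_le_ofReal (h.2 k)).trans_eq ?_
  rw [ENNReal.ofReal_mul (by linarith [(hS.2.1 k).1]),
    ENNReal.ofReal_toReal (measure_ne_top _ _), P_fst_eq, mul_comm]

theorem elog_const (n : ℕ) (x : ℝ) : elog (P n) (fun _ => x) = (Real.log x : EReal) := by
  simp only [elog, lintegral_const, measure_univ, mul_one]
  rw [EReal.coe_ennreal_ofReal, EReal.coe_ennreal_ofReal, ← EReal.coe_sub]
  congr 1
  rcases le_total 0 (Real.log x) with h | h <;> simp [h]

/-- Jensen's inequality for the logarithmic utility. -/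
theorem elog_le_of_lintegral_le {μ : Measure Omega} [IsProbabilityMeasure μ] {f : Omega → ℝ}
    {x : ℝ} (hx : 0 < x) (hf : ∀ᵐ ω ∂μ, 0 < f ω)
    (hle : ∫⁻ ω, ENNReal.ofReal (f ω) ∂μ ≤ ENNReal.ofReal x) :
    elog μ f ≤ (Real.log x : EReal) := by
  have hf0 : 0 ≤ᵐ[μ] f := hf.mono fun ω h => h.le
  have hfm : AEStronglyMeasurable f μ := Measurable.of_discrete.aestronglyMeasurable
  have hlm : AEStronglyMeasurable (fun ω => Real.log (f ω)) μ :=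
    Measurable.of_discrete.aestronglyMeasurable
  have hfi : Integrable f μ :=
    ⟨hfm, (hasFiniteIntegral_iff_ofReal hf0).2 (hle.trans_lt ENNReal.ofReal_lt_top)⟩
  have hpos : ∫⁻ ω, ENNReal.ofReal (Real.log (f ω)) ∂μ ≠ ∞ := by
    refine ne_top_of_le_ne_top (hle.trans_lt ENNReal.ofReal_lt_top).ne
      (lintegral_mono_ae (hf.mono fun ω h => ENNReal.ofReal_le_ofReal ?_))
    linarith [Real.log_le_sub_one_of_pos h]
  by_cases hneg : ∫⁻ ω, ENNReal.ofReal (-Real.log (f ω)) ∂μ = ∞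
  · rw [elog, hneg, EReal.coe_ennreal_top, EReal.sub_top]
    exact bot_le
  have hli : Integrable (fun ω => Real.log (f ω)) μ := by
    refine ⟨hlm, ?_⟩
    rw [hasFiniteIntegral_iff_norm]
    refine lt_of_le_of_lt (lintegral_mono fun ω => ?_)
      (lintegral_add_left (μ := μ) (Measurable.of_discrete
        (f := fun ω => ENNReal.ofReal (Real.log (f ω))))
        (fun ω => ENNReal.ofReal (-Real.log (f ω))) ▸
        (ENNReal.add_ne_top.2 ⟨hpos, hneg⟩).lt_top)
    rcases le_total 0 (Real.log (f ω)) with h | h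
    · rw [Real.norm_of_nonneg h]
      exact le_self_add
    · rw [Real.norm_of_nonpos h]
      exact le_add_self
  have helog : elog μ f = ((∫ ω, Real.log (f ω) ∂μ : ℝ) : EReal) := by
    rw [integral_eq_lintegral_pos_part_sub_lintegral_neg_part hli, EReal.coe_sub,
      EReal.coe_ennreal_toReal hpos, EReal.coe_ennreal_toReal hneg, elog]
  have hfx : ∫ ω, f ω ∂μ ≤ x := by
    rw [integral_eq_lintegral_of_nonneg_ae hf0 hfm]
    exact ENNReal.toReal_le_of_le_ofReal hx.le hle
  rw [helog, EReal.coe_le_coe_iff]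
  calc ∫ ω, Real.log (f ω) ∂μ
      ≤ ∫ ω, (f ω / x + (Real.log x - 1)) ∂μ := by
        refine integral_mono_ae hli ((hfi.div_const x).add (integrable_const _))
          (hf.mono fun ω h => ?_)
        have := Real.log_le_sub_one_of_pos (div_pos h hx)
        rw [Real.log_div h.ne' hx.ne'] at this
        simp only
        linarith
    _ = (∫ ω, f ω ∂μ) / x + (Real.log x - 1) := by
        rw [integral_add (hfi.div_const x) (integrable_const _), integral_div]
        simp
    _ ≤ Real.log x := by
        have := (div_le_one hx).2 hfx
        linarith

/-- With transaction costs and without short selling, the liquidation value never increases. -/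
theorem SelfFinancingTC.a2_le {x : ℝ} {φ : Strat} (h : SelfFinancingTC x 0 φ) (hφ : NoShort φ)
    (hl : ∀ ω, φ.b2 ω = 0) (ω : Omega) : φ.a2 ω ≤ x := by
  obtain ⟨h0, h1, h2⟩ := h
  obtain ⟨-, hb0, hab1, -⟩ := hφ
  have h1 := h1 ω.1
  have h2 := h2 ω
  have hb1 := (hab1 ω.1).2
  rw [hl ω, max_eq_right (by linarith), max_eq_left (by linarith)] at h2
  rw [max_eq_left (by linarith), max_eq_right (by linarith)] at h0
  have hk : (0 : ℝ) ≤ (ω.1 : ℝ) := Nat.cast_nonneg _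
  simp only [ask1] at h1
  rcases le_total (φ.b1 ω.1) φ.b0 with hb | hb
  · rw [max_eq_right (by linarith), max_eq_left (by linarith)] at h1
    linarith
  · rw [max_eq_left (by linarith), max_eq_right (by linarith)] at h1
    nlinarith [mul_nonneg (sub_nonneg.2 hb) hk]

theorem SelfFinancingFL.lintegral_a2_le {n : ℕ} {x : ℝ} {S : PriceProc} {φ : Strat}
    (h : SelfFinancingFL x 0 S φ) (hφ : NoShort φ) (hl : ∀ ω, φ.b2 ω = 0)
    (hS : SpreadValued S) (hm : IsSupermartingaleProc n S) :
    ∫⁻ ω, ENNReal.ofReal (φ.a2 ω) ∂(P n) ≤ ENNReal.ofReal x := by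
  obtain ⟨h0, h1, h2⟩ := h
  obtain ⟨ha0, hb0, hab1, -⟩ := hφ
  have hs1 : ∀ k, 0 ≤ S.s1 k := fun k => by linarith [(hS.2.1 k).1]
  have hs2 : ∀ ω, 0 ≤ S.s2 ω := fun ω => zero_le_one.trans (hS.2.2 ω).1
  have ha2 : ∀ ω, ENNReal.ofReal (φ.a2 ω)
      = ENNReal.ofReal (φ.a1 ω.1) + ENNReal.ofReal (φ.b1 ω.1) * ENNReal.ofReal (S.s2 ω) := by
    intro ω
    have h2 := h2 ω
    rw [hl ω] at h2
    rw [← ENNReal.ofReal_mul (hab1 _).2,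
      ← ENNReal.ofReal_add (hab1 _).1 (mul_nonneg (hab1 _).2 (hs2 ω))]
    congr 1
    linarith
  have ha1 : ∀ k, ENNReal.ofReal (φ.a1 k) + ENNReal.ofReal (φ.b1 k) * ENNReal.ofReal (S.s1 k)
      = ENNReal.ofReal φ.a0 + ENNReal.ofReal φ.b0 * ENNReal.ofReal (S.s1 k) := by
    intro k
    have h1 := h1 k
    rw [← ENNReal.ofReal_mul (hab1 _).2, ← ENNReal.ofReal_mul hb0,
      ← ENNReal.ofReal_add (hab1 _).1 (mul_nonneg (hab1 _).2 (hs1 k)),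
      ← ENNReal.ofReal_add ha0 (mul_nonneg hb0 (hs1 k))]
    congr 1
    linarith
  rw [lintegral_P]
  simp only [ha2]
  calc ∑' k, (w n (k, true) * (ENNReal.ofReal (φ.a1 k)
            + ENNReal.ofReal (φ.b1 k) * ENNReal.ofReal (S.s2 (k, true)))
          + w n (k, false) * (ENNReal.ofReal (φ.a1 k)
            + ENNReal.ofReal (φ.b1 k) * ENNReal.ofReal (S.s2 (k, false))))
      = ∑' k, ((w n (k, true) + w n (k, false)) * ENNReal.ofReal (φ.a1 k)
          + ENNReal.ofReal (φ.b1 k) * (w n (k, true) * ENNReal.ofReal (S.s2 (k, true))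
            + w n (k, false) * ENNReal.ofReal (S.s2 (k, false)))) :=
        tsum_congr fun k => by ring
    _ ≤ ∑' k, (pk n k * ENNReal.ofReal (φ.a1 k)
          + ENNReal.ofReal (φ.b1 k) * (pk n k * ENNReal.ofReal (S.s1 k))) := by
        refine ENNReal.tsum_le_tsum fun k => ?_
        rw [w_true_add_w_false]
        gcongr
        exact hm.sum_s2_le hS k
    _ = ∑' k, (pk n k * ENNReal.ofReal φ.a0
          + ENNReal.ofReal φ.b0 * (pk n k * ENNReal.ofReal (S.s1 k))) :=
        tsum_congr fun k => by
          rw [mul_left_comm, ← mul_add, ha1 k, mul_add, mul_left_comm]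
    _ = ENNReal.ofReal φ.a0 + ENNReal.ofReal φ.b0 * ∑' k, pk n k * ENNReal.ofReal (S.s1 k) := by
        rw [ENNReal.tsum_add, ENNReal.tsum_mul_right, tsum_pk, one_mul, ENNReal.tsum_mul_left]
    _ ≤ ENNReal.ofReal φ.a0 + ENNReal.ofReal φ.b0 * ENNReal.ofReal S.s0 := by
        gcongr
        exact hm.tsum_s1_le hS
    _ = ENNReal.ofReal x := by
        have hs0 : 0 ≤ S.s0 := by linarith [hS.1]
        rw [← ENNReal.ofReal_mul hb0, ← ENNReal.ofReal_add ha0 (mul_nonneg hb0 hs0)]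
        congr 1
        linarith

/-- The strategy that keeps the amount `x` in the safe asset. -/
def noTrade (x : ℝ) : Strat := ⟨x, 0, fun _ => x, fun _ => 0, fun _ => x, fun _ => 0⟩

theorem noShort_noTrade {x : ℝ} (hx : 0 ≤ x) : NoShort (noTrade x) := by
  simp [NoShort, noTrade, hx]

/-- under short selling constraints and initial position `(x, 0)` with `x > 0`,
the constrained transaction-cost value equals `log x` (no trade is optimal), and for every
spread-valued adapted supermartingale `S̃` the constrained frictionless value also equals
`log x`; hence every spread-valued adapted supermartingale is a shadow price for the
constrained problem (in particular, shadow prices need not be unique). -/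
theorem stmt_6 (n : ℕ) (hn : 1 ≤ n) (x : ℝ) (hx : 0 < x) :
    JTCc n x = ((Real.log x : ℝ) : EReal) ∧
    ∀ S : PriceProc, SpreadValued S → IsSupermartingaleProc n S →
      JFLc n x S = ((Real.log x : ℝ) : EReal) := by
  constructor
  · refine le_antisymm (sSup_le ?_) (le_sSup ?_)
    · rintro _ ⟨φ, hsf, hns, hl, hpos, rfl⟩
      refine elog_le_of_lintegral_le hx hpos ?_
      calc ∫⁻ ω, ENNReal.ofReal (φ.a2 ω) ∂(P n)
          ≤ ∫⁻ _, ENNReal.ofReal x ∂(P n) :=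
            lintegral_mono fun ω => ENNReal.ofReal_le_ofReal (hsf.a2_le hns hl ω)
        _ = ENNReal.ofReal x := by simp
    · exact ⟨noTrade x, by simp [SelfFinancingTC, noTrade], noShort_noTrade hx.le,
        fun _ => rfl, ae_of_all _ fun _ => hx, (elog_const n x).symm⟩
  · intro S hS hm
    refine le_antisymm (sSup_le ?_) (le_sSup ?_)
    · rintro _ ⟨φ, hsf, hns, hl, hpos, rfl⟩
      exact elog_le_of_lintegral_le hx hpos (hsf.lintegral_a2_le hns hl hS hm)
    · exact ⟨noTrade x, by simp [SelfFinancingFL, noTrade], noShort_noTrade hx.le,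
        fun _ => rfl, ae_of_all _ fun _ => hx, (elog_const n x).symm⟩
end
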